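/- If m_A = m_C, then the AC cylinder is the flat cylinder {(x, y, w) ∈ ℝ³ : y = m_A·x + (b_A·w)/2 and 2·b_A²·w² ≤ 1 + m_A²}, i.e. the set of points of the plane y = m_A·x + (b_A·w)/2 in ℝ³ satisfying 2·b_A²·w² ≤ 1 + m_A². -/

import Mathlib

noncomputable section

open Real Set

/-- Membership predicate for conformally inscribed parallelograms.
Coordinates of `P : Fin 9 → ℝ`:
`0 = x_A, 1 = y_A, 2 = x_B, 3 = y_B, 4 = x_C, 5 = y_C, 6 = x_D, 7 = y_D, 8 = w`.
The vertex `(x_L, y_L)` lies on the line `L(w)` for `L ∈ {A,B,C,D}` and the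
midpoints of the two diagonals coincide. -/
def IsCIP (mA mB mC mD bA : ℝ) (P : Fin 9 → ℝ) : Prop :=
  P 1 = mA * P 0 + bA * P 8 ∧
  P 3 = mB * P 2 + P 8 ∧
  P 5 = mC * P 4 ∧
  P 7 = mD * P 6 ∧
  P 0 + P 4 = P 2 + P 6 ∧
  P 1 + P 5 = P 3 + P 7

/-- `Π`, the set of conformally inscribed parallelograms. -/
def CIP (mA mB mC mD bA : ℝ) : Set (Fin 9 → ℝ) := {P | IsCIP mA mB mC mD bA P}

/-- The `AC` diagonal vector of a parallelogram. -/
def vAC (P : Fin 9 → ℝ) : ℝ × ℝ := (P 0 - P 4, P 1 - P 5)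

/-- The `BD` diagonal vector of a parallelogram. -/
def vBD (P : Fin 9 → ℝ) : ℝ × ℝ := (P 2 - P 6, P 3 - P 7)

/-- The `AB` side vector of a parallelogram. -/
def vAB (P : Fin 9 → ℝ) : ℝ × ℝ := (P 0 - P 2, P 1 - P 3)

/-- The `BC` side vector of a parallelogram. -/
def vBC (P : Fin 9 → ℝ) : ℝ × ℝ := (P 2 - P 4, P 3 - P 5)

/-- Dot product in `ℝ²`. -/
def dot2 (a b : ℝ × ℝ) : ℝ := a.1 * b.1 + a.2 * b.2

/-- The inner product `⟨P, Q⟩ = P_AC · Q_AC + P_BD · Q_BD` on `Π`. -/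
def pinner (P Q : Fin 9 → ℝ) : ℝ := dot2 (vAC P) (vAC Q) + dot2 (vBD P) (vBD Q)

/-- The `AC` cylinder: the set of `(x, y, w) ∈ ℝ³` such that `(x, y)` is the
midpoint of a segment of squared length `1/2` joining `A(w)` and `C(w)`. -/
def ACcyl (mA bA mC : ℝ) : Set (ℝ × ℝ × ℝ) :=
  {v | ∃ xA yA xC yC : ℝ, yA = mA * xA + bA * v.2.2 ∧ yC = mC * xC ∧
      2 * v.1 = xA + xC ∧ 2 * v.2.1 = yA + yC ∧
      (xA - xC) ^ 2 + (yA - yC) ^ 2 = 1 / 2}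

theorem stmt_18 (mA mB mC mD bA : ℝ) (hCD : mC ≠ mD) (hAC : mA = mC) :
    ACcyl mA bA mC =
      {v : ℝ × ℝ × ℝ | v.2.1 = mA * v.1 + bA * v.2.2 / 2 ∧
        2 * bA ^ 2 * v.2.2 ^ 2 ≤ 1 + mA ^ 2} := by
  subst hAC
  have hm : 0 < 1 + mA ^ 2 := by positivity
  ext ⟨x, y, w⟩
  simp only [ACcyl, mem_ofPred_eq]
  constructor
  · rintro ⟨xA, yA, xC, yC, rfl, rfl, hx, hy, hd⟩
    refine ⟨by linear_combination hy / 2 - mA / 2 * hx, ?_⟩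
    linear_combination 2 * sq_nonneg ((1 + mA ^ 2) * (xA - xC) + mA * (bA * w)) +
      2 * (1 + mA ^ 2) * hd
  · rintro ⟨rfl, hw⟩
    have hr := Real.sq_sqrt (show 0 ≤ (1 + mA ^ 2) / 2 - bA ^ 2 * w ^ 2 by linarith)
    set r := √((1 + mA ^ 2) / 2 - bA ^ 2 * w ^ 2)
    obtain ⟨t, ht⟩ : ∃ t, (1 + mA ^ 2) * t = r - mA * (bA * w) :=
      ⟨(r - mA * (bA * w)) / (1 + mA ^ 2), by field_simp⟩
    refine ⟨x + t / 2, _, x - t / 2, _, rfl, rfl, by ring, by ring, ?_⟩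
    apply mul_left_cancel₀ hm.ne'
    linear_combination hr + ((1 + mA ^ 2) * t + mA * (bA * w) + r) * ht
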